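/- arXiv:2305.04263 — 8 statements merged into one kernel-verified Lean document; each statement's English description precedes it below -/
import Mathlib

section
/- (Generalized (p,q)-super Virasoro algebra with conformal dimension Δ = 1: unrescaled relation.) Let p, q > 0 be reals with p ≠ q, and let n, m be integers with n ≠ m. Put û = [n−m]_{p,q}/[m−n]_{p,q} and v̂ = p^{m−n}·û. Then û·𝓛¹_n∘𝓛¹_m − v̂·𝓛¹_m∘𝓛¹_n = [n−m]_{p,q} · q^{N₁−m} ∘ 𝓛¹_{n+m}; explicitly, for every k ∈ ℤ: û·[k+1]_{p,q}·[k+m+1]_{p,q} − v̂·[k+1]_{p,q}·[k+n+1]_{p,q} = [n−m]_{p,q} · q^{k+n+1} · [k+1]_{p,q}. -/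
/-- The `(p,q)`-deformed number `[x]_{p,q} = (p^x - q^x)/(p - q)` (real powers). -/
noncomputable def pqNum (p q x : ℝ) : ℝ := (p ^ x - q ^ x) / (p - q)

theorem pqNum_ne_zero {p q x : ℝ} (hp : 0 < p) (hq : 0 < q) (hpq : p ≠ q) (hx : x ≠ 0) :
    pqNum p q x ≠ 0 :=
  div_ne_zero
    (sub_ne_zero.2 fun h => hpq (Real.rpow_left_injOn hx hp.le hq.le h))
    (sub_ne_zero.2 hpq)

theorem pqNum_add_sub_rpow_mul {p q : ℝ} (hp : 0 < p) (hq : 0 < q) (x y : ℝ) :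
    pqNum p q (x + y) - p ^ x * pqNum p q y = q ^ y * pqNum p q x := by
  simp only [pqNum, Real.rpow_add hp, Real.rpow_add hq]
  ring

/-- Generalized (p,q)-super Virasoro algebra with conformal dimension Δ = 1:
unrescaled relation (coefficient identity on basis monomials `z^k`). -/
theorem pq_super_virasoro_dim_one_unrescaled
    (p q : ℝ) (hp : 0 < p) (hq : 0 < q) (hpq : p ≠ q)
    (n m : ℤ) (hnm : n ≠ m)
    (u v : ℝ)
    (hu : u = pqNum p q ((n : ℝ) - (m : ℝ)) / pqNum p q ((m : ℝ) - (n : ℝ)))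
    (hv : v = p ^ ((m : ℝ) - (n : ℝ)) * u) :
    ∀ k : ℤ,
      u * pqNum p q ((k : ℝ) + 1) * pqNum p q ((k : ℝ) + (m : ℝ) + 1)
        - v * pqNum p q ((k : ℝ) + 1) * pqNum p q ((k : ℝ) + (n : ℝ) + 1)
      = pqNum p q ((n : ℝ) - (m : ℝ)) * q ^ ((k : ℝ) + (n : ℝ) + 1) *
          pqNum p q ((k : ℝ) + 1) := by
  intro k
  have hne : pqNum p q ((m : ℝ) - n) ≠ 0 :=
    pqNum_ne_zero hp hq hpq (sub_ne_zero.2 (by exact_mod_cast hnm.symm))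
  have hu' : u * pqNum p q ((m : ℝ) - n) = pqNum p q ((n : ℝ) - m) := by
    rw [hu, div_mul_cancel₀ _ hne]
  have h := pqNum_add_sub_rpow_mul hp hq ((m : ℝ) - n) ((k : ℝ) + n + 1)
  rw [show (m : ℝ) - n + (k + n + 1) = k + m + 1 by ring] at h
  rw [hv, ← hu']
  linear_combination u * pqNum p q ((k : ℝ) + 1) * h
end

section
/- (Product relation for ℛ(p,q)-conformal operators, Δ ≠ 0,1.) Let τ₁, τ₂ > 0 be reals with τ₁ ≠ τ₂, let a, b be nonzero reals with a + b ≠ 0, let Δ ∈ ℝ and m, n ∈ ℤ. Then [Δ(n+1)]_b · [Δ(m+1)+n]_a = ((τ₁^{a+b} − τ₂^{a+b}) · τ₁^{an(1−Δ)}) / ((τ₁^a − τ₂^a)(τ₁^b − τ₂^b) · τ₁^{bΔm}) · [Δ(m+n+1)]_{a+b} + τ₂^{(a+b)Δ(m+n+1)} · [−Δm]_b · [n(1−Δ)]_a − (τ₂^{a(Δ(m+1)+n)} / (τ₁^{bΔm}(τ₁^a − τ₂^a))) · [Δ(m+n+1)]_b − (τ₂^{bΔ(n+1)} / (τ₁^{an(Δ−1)}(τ₁^b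 − τ₂^b))) · [Δ(m+n+1)]_a. (This is the coefficient identity expressing the operator product 𝒯^{aΔ}_m ∘ 𝒯^{bΔ}_n applied to 1, where 𝒯^{aΔ}_m(x^k) = [Δ(m+1)+k]_a x^{k+m}.) -/
/-- The ℛ(p,q)-deformed number in τ-form:
`[x]_c = (τ₁^{cx} - τ₂^{cx})/(τ₁^c - τ₂^c)` (real powers of positive bases). -/
noncomputable def tauNum (t1 t2 c x : ℝ) : ℝ :=
  (t1 ^ (c * x) - t2 ^ (c * x)) / (t1 ^ c - t2 ^ c)

theorem rpow_sub_rpow_ne_zero {x y c : ℝ} (hx : 0 < x) (hy : 0 < y) (hxy : x ≠ y) (hc : c ≠ 0) :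
    x ^ c - y ^ c ≠ 0 :=
  sub_ne_zero.mpr fun h => hxy ((Real.rpow_left_inj hx.le hy.le hc).mp h)

/-- Product relation for ℛ(p,q)-conformal operators `𝒯^{aΔ}_m`, coefficient identity. -/
theorem rpq_conformal_operator_product
    (t1 t2 : ℝ) (h1 : 0 < t1) (h2 : 0 < t2) (h12 : t1 ≠ t2)
    (a b : ℝ) (ha : a ≠ 0) (hb : b ≠ 0) (hab : a + b ≠ 0)
    (Δ : ℝ) (m n : ℤ) :
    tauNum t1 t2 b (Δ * ((n : ℝ) + 1)) * tauNum t1 t2 a (Δ * ((m : ℝ) + 1) + (n : ℝ))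
      = (t1 ^ (a + b) - t2 ^ (a + b)) * t1 ^ (a * (n : ℝ) * (1 - Δ)) /
          ((t1 ^ a - t2 ^ a) * (t1 ^ b - t2 ^ b) * t1 ^ (b * Δ * (m : ℝ))) *
          tauNum t1 t2 (a + b) (Δ * ((m : ℝ) + (n : ℝ) + 1))
        + t2 ^ ((a + b) * Δ * ((m : ℝ) + (n : ℝ) + 1)) *
          tauNum t1 t2 b (-(Δ * (m : ℝ))) * tauNum t1 t2 a ((n : ℝ) * (1 - Δ))
        - t2 ^ (a * (Δ * ((m : ℝ) + 1) + (n : ℝ))) /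
            (t1 ^ (b * Δ * (m : ℝ)) * (t1 ^ a - t2 ^ a)) *
          tauNum t1 t2 b (Δ * ((m : ℝ) + (n : ℝ) + 1))
        - t2 ^ (b * Δ * ((n : ℝ) + 1)) /
            (t1 ^ (a * (n : ℝ) * (Δ - 1)) * (t1 ^ b - t2 ^ b)) *
          tauNum t1 t2 a (Δ * ((m : ℝ) + (n : ℝ) + 1)) := by
  have hA := rpow_sub_rpow_ne_zero h1 h2 h12 ha
  have hB := rpow_sub_rpow_ne_zero h1 h2 h12 hb
  have hAB := rpow_sub_rpow_ne_zero h1 h2 h12 hab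
  obtain ⟨s, hs⟩ : ∃ s, s = Δ * ((m : ℝ) + (n : ℝ) + 1) := ⟨_, rfl⟩
  have factor_b (t : ℝ) (ht : 0 < t) :
      t ^ (b * (Δ * ((n : ℝ) + 1))) = t ^ (b * -(Δ * (m : ℝ))) * t ^ (b * s) := by
    rw [← Real.rpow_add ht, hs]; ring_nf
  have factor_a (t : ℝ) (ht : 0 < t) :
      t ^ (a * (Δ * ((m : ℝ) + 1) + (n : ℝ))) = t ^ (a * ((n : ℝ) * (1 - Δ))) * t ^ (a * s) := by
    rw [← Real.rpow_add ht, hs]; ring_nf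
  have factor_s (t : ℝ) (ht : 0 < t) : t ^ ((a + b) * s) = t ^ (a * s) * t ^ (b * s) := by
    rw [← Real.rpow_add ht, add_mul]
  have inv_b : t1 ^ (b * Δ * (m : ℝ)) = (t1 ^ (b * -(Δ * (m : ℝ))))⁻¹ := by
    rw [← Real.rpow_neg h1.le]; ring_nf
  have inv_a : t1 ^ (a * (n : ℝ) * (Δ - 1)) = (t1 ^ (a * ((n : ℝ) * (1 - Δ))))⁻¹ := by
    rw [← Real.rpow_neg h1.le]; ring_nf
  have hP := (Real.rpow_pos_of_pos h1 (b * -(Δ * (m : ℝ)))).ne'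
  have hQ := (Real.rpow_pos_of_pos h1 (a * ((n : ℝ) * (1 - Δ)))).ne'
  simp only [tauNum]
  rw [mul_assoc (a + b) Δ, mul_assoc a (n : ℝ) (1 - Δ), mul_assoc b Δ ((n : ℝ) + 1), ← hs,
    inv_b, inv_a, factor_b t1 h1, factor_b t2 h2, factor_a t1 h1, factor_a t2 h2,
    factor_s t1 h1, factor_s t2 h2]
  generalize t1 ^ (b * -(Δ * (m : ℝ))) = P at *
  generalize t1 ^ (a * ((n : ℝ) * (1 - Δ))) = Q at *
  generalize t1 ^ a - t2 ^ a = A at *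
  generalize t1 ^ b - t2 ^ b = B at *
  generalize t1 ^ (a + b) - t2 ^ (a + b) = C at *
  field_simp
  ring
end

section
/- (Commutation relation for ℛ(p,q)-conformal operators, Δ ≠ 0,1.) Let τ₁, τ₂ > 0 be reals with τ₁ ≠ τ₂, let a, b be nonzero reals with a + b ≠ 0, let Δ ∈ ℝ and m, n ∈ ℤ. Then [Δ(n+1)]_b·[Δ(m+1)+n]_a − [Δ(m+1)]_a·[Δ(n+1)+m]_b = ((τ₁^{a+b} − τ₂^{a+b})/((τ₁^a − τ₂^a)(τ₁^b − τ₂^b))) · ( τ₁^{an(1−Δ)}/τ₁^{bΔm} − τ₁^{bm(1−Δ)}/τ₁^{aΔn} ) · [Δ(m+n+1)]_{a+b} − (τ₂^{bΔ(n+1)}/τ₁^{aΔn}) · ((τ₁^{an} − τ₂^{bm})/(τ₁^b − τ₂^b)) · [Δ(m+n+1)]_a + (τ₂^{aΔ(m+1)}/τ₁^{bΔm}) · ((τ₁^{bm} − τ₂^{an})/(τ₁^a − τ₂^a)) · [Δ(m+n+1)]_b + τ₂^{(a+b)Δ(m+n+1)}·( [−Δm]_b·[n(1−Δ)]_a − [−Δn]_a·[m(1−Δ)]_b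 ). (This is the coefficient identity for the commutator 𝒯^{aΔ}_m ∘ 𝒯^{bΔ}_n − 𝒯^{bΔ}_n ∘ 𝒯^{aΔ}_m applied to 1, where 𝒯^{aΔ}_m(x^k) = [Δ(m+1)+k]_a x^{k+m}.) -/
theorem rpow_sub_rpow_ne_zero_s9 {t1 t2 c : ℝ} (h1 : 0 < t1) (h2 : 0 < t2) (h12 : t1 ≠ t2)
    (hc : c ≠ 0) : t1 ^ c - t2 ^ c ≠ 0 :=
  sub_ne_zero.mpr fun h => h12 ((Real.rpow_left_inj h1.le h2.le hc).mp h)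

/-- Commutation relation for ℛ(p,q)-conformal operators `𝒯^{aΔ}_m`, coefficient identity. -/
theorem rpq_conformal_operator_commutator
    (t1 t2 : ℝ) (h1 : 0 < t1) (h2 : 0 < t2) (h12 : t1 ≠ t2)
    (a b : ℝ) (ha : a ≠ 0) (hb : b ≠ 0) (hab : a + b ≠ 0)
    (Δ : ℝ) (m n : ℤ) :
    tauNum t1 t2 b (Δ * ((n : ℝ) + 1)) * tauNum t1 t2 a (Δ * ((m : ℝ) + 1) + (n : ℝ))
      - tauNum t1 t2 a (Δ * ((m : ℝ) + 1)) * tauNum t1 t2 b (Δ * ((n : ℝ) + 1) + (m : ℝ))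
    = (t1 ^ (a + b) - t2 ^ (a + b)) / ((t1 ^ a - t2 ^ a) * (t1 ^ b - t2 ^ b)) *
        (t1 ^ (a * (n : ℝ) * (1 - Δ)) / t1 ^ (b * Δ * (m : ℝ))
          - t1 ^ (b * (m : ℝ) * (1 - Δ)) / t1 ^ (a * Δ * (n : ℝ))) *
        tauNum t1 t2 (a + b) (Δ * ((m : ℝ) + (n : ℝ) + 1))
      - t2 ^ (b * Δ * ((n : ℝ) + 1)) / t1 ^ (a * Δ * (n : ℝ)) *
          ((t1 ^ (a * (n : ℝ)) - t2 ^ (b * (m : ℝ))) / (t1 ^ b - t2 ^ b)) *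
          tauNum t1 t2 a (Δ * ((m : ℝ) + (n : ℝ) + 1))
      + t2 ^ (a * Δ * ((m : ℝ) + 1)) / t1 ^ (b * Δ * (m : ℝ)) *
          ((t1 ^ (b * (m : ℝ)) - t2 ^ (a * (n : ℝ))) / (t1 ^ a - t2 ^ a)) *
          tauNum t1 t2 b (Δ * ((m : ℝ) + (n : ℝ) + 1))
      + t2 ^ ((a + b) * Δ * ((m : ℝ) + (n : ℝ) + 1)) *
          (tauNum t1 t2 b (-(Δ * (m : ℝ))) * tauNum t1 t2 a ((n : ℝ) * (1 - Δ))
            - tauNum t1 t2 a (-(Δ * (n : ℝ))) * tauNum t1 t2 b ((m : ℝ) * (1 - Δ))) := by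
  have hA := rpow_sub_rpow_ne_zero_s9 h1 h2 h12 ha
  have hB := rpow_sub_rpow_ne_zero_s9 h1 h2 h12 hb
  have hAB := rpow_sub_rpow_ne_zero_s9 h1 h2 h12 hab
  unfold tauNum
  generalize (m : ℝ) = m, (n : ℝ) = n
  generalize t1 ^ a - t2 ^ a = A at *
  generalize t1 ^ b - t2 ^ b = B at *
  generalize t1 ^ (a + b) - t2 ^ (a + b) = C at *
  simp only [
    show b * (Δ * (n + 1)) = b * Δ * n + b * Δ by ring,
    show a * (Δ * (m + 1) + n) = a * Δ * m + a * Δ + a * n by ring,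
    show a * (Δ * (m + 1)) = a * Δ * m + a * Δ by ring,
    show b * (Δ * (n + 1) + m) = b * Δ * n + b * Δ + b * m by ring,
    show a * n * (1 - Δ) = a * n - a * Δ * n by ring,
    show b * m * (1 - Δ) = b * m - b * Δ * m by ring,
    show (a + b) * (Δ * (m + n + 1)) =
      a * Δ * m + a * Δ * n + a * Δ + (b * Δ * m + b * Δ * n + b * Δ) by ring,
    show (a + b) * Δ * (m + n + 1) =
      a * Δ * m + a * Δ * n + a * Δ + (b * Δ * m + b * Δ * n + b * Δ) by ring,
    show a * (Δ * (m + n + 1)) = a * Δ * m + a * Δ * n + a * Δ by ring,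
    show b * (Δ * (m + n + 1)) = b * Δ * m + b * Δ * n + b * Δ by ring,
    show b * Δ * (n + 1) = b * Δ * n + b * Δ by ring,
    show a * Δ * (m + 1) = a * Δ * m + a * Δ by ring,
    show b * -(Δ * m) = -(b * Δ * m) by ring,
    show a * -(Δ * n) = -(a * Δ * n) by ring,
    show a * (n * (1 - Δ)) = a * n - a * Δ * n by ring,
    show b * (m * (1 - Δ)) = b * m - b * Δ * m by ring,
    Real.rpow_add h1, Real.rpow_add h2, Real.rpow_sub h1, Real.rpow_sub h2,
    Real.rpow_neg h1.le, Real.rpow_neg h2.le]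
  have hp (x : ℝ) : t1 ^ x ≠ 0 := (Real.rpow_pos_of_pos h1 x).ne'
  have hq (x : ℝ) : t2 ^ x ≠ 0 := (Real.rpow_pos_of_pos h2 x).ne'
  have := hp (a * Δ * n)
  have := hp (b * Δ * m)
  have := hq (a * Δ * n)
  have := hq (b * Δ * m)
  clear hp hq
  generalize t1 ^ (a * Δ * n) = P1, t1 ^ (b * Δ * m) = P2, t2 ^ (a * Δ * n) = Q1,
    t2 ^ (b * Δ * m) = Q2, t1 ^ (a * Δ * m) = P3, t1 ^ (b * Δ * n) = P4,
    t2 ^ (a * Δ * m) = Q3, t2 ^ (b * Δ * n) = Q4, t1 ^ (a * Δ) = P5, t1 ^ (b * Δ) = P6,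
    t2 ^ (a * Δ) = Q5, t2 ^ (b * Δ) = Q6, t1 ^ (a * n) = P7, t1 ^ (b * m) = P8,
    t2 ^ (a * n) = Q7, t2 ^ (b * m) = Q8 at *
  field_simp
  ring
end

section
/- (Commutation relation for q-conformal operators, one-parameter case.) Let q > 0 be real with q ≠ 1, let a, b be nonzero reals with a + b ≠ 0, let Δ ∈ ℝ and m, n ∈ ℤ, and write [x]_c = (q^{cx} − 1)/(q^c − 1). Then [Δ(n+1)]_b·[Δ(m+1)+n]_a − [Δ(m+1)]_a·[Δ(n+1)+m]_b = ((q^{a+b} − 1)/((q^a − 1)(q^b − 1))) · ( q^{an(1−Δ)}/q^{bΔm} − q^{bm(1−Δ)}/q^{aΔn} ) · [Δ(m+n+1)]_{a+b} − (1/q^{aΔn}) · ((q^{an} − 1)/(q^b − 1)) · [Δ(m+n+1)]_a + (1/q^{bΔm}) · ((q^{bm} − 1)/(q^a − 1)) · [Δ(m+n+1)]_b + ( [−Δm]_b·[n(1−Δ)]_a − [−Δn]_a·[m(1−Δ)]_b ). -/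
/-- The one-parameter `q`-deformed number `[x]_c = (q^{cx} - 1)/(q^c - 1)` (real powers). -/
noncomputable def qcNum (q c x : ℝ) : ℝ := (q ^ (c * x) - 1) / (q ^ c - 1)

theorem rpow_sub_one_ne_zero {q c : ℝ} (hq : 0 < q) (hq1 : q ≠ 1) (hc : c ≠ 0) :
    q ^ c - 1 ≠ 0 := by
  rw [sub_ne_zero]
  intro h
  exact hc ((Real.rpow_right_inj hq hq1).mp (h.trans (Real.rpow_zero q).symm))

/-- Commutation relation for q-conformal operators, one-parameter case. -/
theorem q_conformal_operator_commutator
    (q : ℝ) (hq : 0 < q) (hq1 : q ≠ 1)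
    (a b : ℝ) (ha : a ≠ 0) (hb : b ≠ 0) (hab : a + b ≠ 0)
    (Δ : ℝ) (m n : ℤ) :
    qcNum q b (Δ * ((n : ℝ) + 1)) * qcNum q a (Δ * ((m : ℝ) + 1) + (n : ℝ))
      - qcNum q a (Δ * ((m : ℝ) + 1)) * qcNum q b (Δ * ((n : ℝ) + 1) + (m : ℝ))
    = (q ^ (a + b) - 1) / ((q ^ a - 1) * (q ^ b - 1)) *
        (q ^ (a * (n : ℝ) * (1 - Δ)) / q ^ (b * Δ * (m : ℝ))
          - q ^ (b * (m : ℝ) * (1 - Δ)) / q ^ (a * Δ * (n : ℝ))) *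
        qcNum q (a + b) (Δ * ((m : ℝ) + (n : ℝ) + 1))
      - 1 / q ^ (a * Δ * (n : ℝ)) *
          ((q ^ (a * (n : ℝ)) - 1) / (q ^ b - 1)) *
          qcNum q a (Δ * ((m : ℝ) + (n : ℝ) + 1))
      + 1 / q ^ (b * Δ * (m : ℝ)) *
          ((q ^ (b * (m : ℝ)) - 1) / (q ^ a - 1)) *
          qcNum q b (Δ * ((m : ℝ) + (n : ℝ) + 1))
      + (qcNum q b (-(Δ * (m : ℝ))) * qcNum q a ((n : ℝ) * (1 - Δ))
          - qcNum q a (-(Δ * (n : ℝ))) * qcNum q b ((m : ℝ) * (1 - Δ))) := by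
  have hA := rpow_sub_one_ne_zero hq hq1 ha
  have hB := rpow_sub_one_ne_zero hq hq1 hb
  have hC := rpow_sub_one_ne_zero hq hq1 hab
  have h_shift (c k l : ℝ) :
      q ^ (c * (Δ * (k + 1) + l)) = q ^ (c * (Δ * (k + 1))) * q ^ (c * l) := by
    rw [← Real.rpow_add hq]; ring_nf
  have h_weight (c k : ℝ) : q ^ (c * k * (1 - Δ)) = q ^ (c * k) / q ^ (c * Δ * k) := by
    rw [← Real.rpow_sub hq]; ring_nf
  have h_weight_assoc (c k : ℝ) : q ^ (c * (k * (1 - Δ))) = q ^ (c * k) / q ^ (c * Δ * k) := by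
    rw [← mul_assoc, h_weight]
  have h_neg (c k : ℝ) : q ^ (c * -(Δ * k)) = (q ^ (c * Δ * k))⁻¹ := by
    rw [← Real.rpow_neg hq.le]; ring_nf
  have h_sum_a : q ^ (a * (Δ * ((m : ℝ) + n + 1))) =
      q ^ (a * (Δ * ((m : ℝ) + 1))) * q ^ (a * Δ * (n : ℝ)) := by
    rw [← Real.rpow_add hq]; ring_nf
  have h_sum_b : q ^ (b * (Δ * ((m : ℝ) + n + 1))) =
      q ^ (b * (Δ * ((n : ℝ) + 1))) * q ^ (b * Δ * (m : ℝ)) := by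
    rw [← Real.rpow_add hq]; ring_nf
  have h_sum_ab : q ^ ((a + b) * (Δ * ((m : ℝ) + n + 1))) =
      q ^ (a * (Δ * ((m : ℝ) + n + 1))) * q ^ (b * (Δ * ((m : ℝ) + n + 1))) := by
    rw [← Real.rpow_add hq]; ring_nf
  have hx := (Real.rpow_pos_of_pos hq (a * Δ * (n : ℝ))).ne'
  have hu := (Real.rpow_pos_of_pos hq (b * Δ * (m : ℝ))).ne'
  simp only [qcNum, h_sum_ab, h_shift, h_weight, h_weight_assoc, h_neg, h_sum_a, h_sum_b]
  clear h_sum_ab h_shift h_weight h_weight_assoc h_neg h_sum_a h_sum_b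
  generalize q ^ (a * Δ * (n : ℝ)) = x at *
  generalize q ^ (b * Δ * (m : ℝ)) = u at *
  generalize q ^ (a * (n : ℝ)) = z at *
  generalize q ^ (b * (m : ℝ)) = w at *
  generalize q ^ (a * (Δ * ((m : ℝ) + 1))) = y at *
  generalize q ^ (b * (Δ * ((n : ℝ) + 1))) = v at *
  generalize q ^ (a + b) - 1 = C at *
  generalize q ^ a - 1 = A at *
  generalize q ^ b - 1 = B at *
  field_simp
  ring
end

section
/- (Equal-parameter commutation relation for ℛ(p,q)-conformal operators.) Let τ₁, τ₂ > 0 be reals with τ₁ ≠ τ₂, let a be a nonzero real, let Δ ∈ ℝ and m, n ∈ ℤ. Then [Δ(n+1)]_a·[Δ(m+1)+n]_a − [Δ(m+1)]_a·[Δ(n+1)+m]_a = ( τ₁^{−aΔ(n+m)} (τ₁^{an} − τ₁^{am}) / (τ₁^a − τ₂^a) ) · [2]_a · [Δ(m+n+1)]_{2a} − (1/(τ₁^a − τ₂^a)) · ( (τ₂^{aΔ(n+1)}/τ₁^{aΔn})(τ₁^{an} − τ₂^{am}) − (τ₂^{aΔ(m+1)}/τ₁^{aΔm})(τ₁^{am}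 − τ₂^{an}) ) · [Δ(m+n+1)]_a + τ₂^{2aΔ(m+n+1)}·( [−Δm]_a·[n(1−Δ)]_a − [−Δn]_a·[m(1−Δ)]_a ), where [2]_a = (τ₁^{2a} − τ₂^{2a})/(τ₁^a − τ₂^a). -/
/-- Equal-parameter commutation relation for ℛ(p,q)-conformal operators. -/
theorem rpq_conformal_operator_commutator_equal_param
    (t1 t2 : ℝ) (h1 : 0 < t1) (h2 : 0 < t2) (h12 : t1 ≠ t2)
    (a : ℝ) (ha : a ≠ 0)
    (Δ : ℝ) (m n : ℤ) :
    tauNum t1 t2 a (Δ * ((n : ℝ) + 1)) * tauNum t1 t2 a (Δ * ((m : ℝ) + 1) + (n : ℝ))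
      - tauNum t1 t2 a (Δ * ((m : ℝ) + 1)) * tauNum t1 t2 a (Δ * ((n : ℝ) + 1) + (m : ℝ))
    = t1 ^ (-(a * Δ * ((n : ℝ) + (m : ℝ)))) * (t1 ^ (a * (n : ℝ)) - t1 ^ (a * (m : ℝ))) /
          (t1 ^ a - t2 ^ a) *
        ((t1 ^ (2 * a) - t2 ^ (2 * a)) / (t1 ^ a - t2 ^ a)) *
        tauNum t1 t2 (2 * a) (Δ * ((m : ℝ) + (n : ℝ) + 1))
      - (t1 ^ a - t2 ^ a)⁻¹ *
          (t2 ^ (a * Δ * ((n : ℝ) + 1)) / t1 ^ (a * Δ * (n : ℝ)) *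
              (t1 ^ (a * (n : ℝ)) - t2 ^ (a * (m : ℝ)))
            - t2 ^ (a * Δ * ((m : ℝ) + 1)) / t1 ^ (a * Δ * (m : ℝ)) *
              (t1 ^ (a * (m : ℝ)) - t2 ^ (a * (n : ℝ)))) *
          tauNum t1 t2 a (Δ * ((m : ℝ) + (n : ℝ) + 1))
      + t2 ^ (2 * a * Δ * ((m : ℝ) + (n : ℝ) + 1)) *
          (tauNum t1 t2 a (-(Δ * (m : ℝ))) * tauNum t1 t2 a ((n : ℝ) * (1 - Δ))
            - tauNum t1 t2 a (-(Δ * (n : ℝ))) * tauNum t1 t2 a ((m : ℝ) * (1 - Δ))) := by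
  have d : t1 ^ a - t2 ^ a ≠ 0 := by
    rw [sub_ne_zero]
    exact fun h => h12 ((Real.rpow_left_inj h1.le h2.le ha).mp h)
  have e : t1 ^ a + t2 ^ a ≠ 0 := by positivity
  have exp_shift (k : ℝ) : a * (Δ * (k + 1)) = a * Δ * k + a * Δ := by ring
  have exp_shift' (k : ℝ) : a * Δ * (k + 1) = a * Δ * k + a * Δ := by ring
  have exp_shift_add (k l : ℝ) : a * (Δ * (k + 1) + l) = a * Δ * k + a * Δ + a * l := by ring
  have exp_neg_add (k l : ℝ) : -(a * Δ * (k + l)) = -(a * Δ * k) + -(a * Δ * l) := by ring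
  have exp_sum (k l : ℝ) : a * (Δ * (k + l + 1)) = a * Δ * k + a * Δ * l + a * Δ := by ring
  have exp_two_sum (k l : ℝ) : 2 * a * (Δ * (k + l + 1)) =
      2 * (a * Δ * k + a * Δ * l + a * Δ) := by ring
  have exp_two_sum' (k l : ℝ) : 2 * a * Δ * (k + l + 1) =
      2 * (a * Δ * k + a * Δ * l + a * Δ) := by ring
  have exp_neg (k : ℝ) : a * -(Δ * k) = -(a * Δ * k) := by ring
  have exp_one_sub (k : ℝ) : a * (k * (1 - Δ)) = a * k + -(a * Δ * k) := by ring
  simp only [tauNum]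
  rw [exp_shift_add, exp_shift_add, exp_sum, exp_two_sum, exp_two_sum', exp_neg, exp_neg,
    exp_one_sub, exp_one_sub, exp_neg_add, exp_shift, exp_shift, exp_shift', exp_shift']
  simp only [two_mul, Real.rpow_add h1, Real.rpow_add h2, Real.rpow_neg h1.le, Real.rpow_neg h2.le]
  have hs (x : ℝ) : t1 ^ x ≠ 0 := (Real.rpow_pos_of_pos h1 x).ne'
  have ht (x : ℝ) : t2 ^ x ≠ 0 := (Real.rpow_pos_of_pos h2 x).ne'
  have hPn := hs (a * Δ * n)
  have hPm := hs (a * Δ * m)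
  have hQn := ht (a * Δ * n)
  have hQm := ht (a * Δ * m)
  generalize t1 ^ (a * Δ * (n : ℝ)) = Pn at *
  generalize t1 ^ (a * Δ * (m : ℝ)) = Pm at *
  generalize t2 ^ (a * Δ * (n : ℝ)) = Qn at *
  generalize t2 ^ (a * Δ * (m : ℝ)) = Qm at *
  generalize t1 ^ (a * Δ) = P, t2 ^ (a * Δ) = Q, t1 ^ (a * (n : ℝ)) = Sn,
    t1 ^ (a * (m : ℝ)) = Sm, t2 ^ (a * (n : ℝ)) = Tn, t2 ^ (a * (m : ℝ)) = Tm
  generalize t1 ^ a = S at *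
  generalize t2 ^ a = T at *
  have sq_sub_sq_eq : S * S - T * T = (S - T) * (S + T) := by ring
  rw [sq_sub_sq_eq]
  field_simp
  ring
end

section
/- (Super commutation relation for ℛ(p,q)-conformal super operators, Δ ≠ 0,1.) Let τ₁, τ₂ > 0 be reals with τ₁ ≠ τ₂, let a, b be nonzero reals with a + b ≠ 0, let Δ ∈ ℝ and m, n ∈ ℤ. Then [Δ(n+1)]_b·[Δ(m+1)+n+1]_a − [Δ(m+1)]_a·[Δ(n+1)+m+1]_b = ((τ₁^{a+b} − τ₂^{a+b})/((τ₁^a − τ₂^a)(τ₁^b − τ₂^b))) · ( τ₁^{a(n(1−Δ)+1)}/τ₁^{bΔm} − τ₁^{b(m(1−Δ)+1)}/τ₁^{aΔn} ) · [Δ(m+n+1)]_{a+b} − (τ₂^{bΔ(n+1)}/τ₁^{aΔn}) · ((τ₁^{a(n+1)} − τ₂^{b(m+1)})/(τ₁^b − τ₂^b)) · [Δ(m+n+1)]_a + (τ₂^{aΔ(m+1)}/τ₁^{bΔm}) · ((τ₁^{b(m+1)} − τ₂^{a(n+1)})/(τ₁^a − τ₂^a)) · [Δ(m+n+1)]_b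 + τ₂^{(a+b)Δ(m+n+1)}·( [−Δm]_b·[n(1−Δ)+1]_a − [−Δn]_a·[m(1−Δ)+1]_b ). (This is the coefficient identity for the bracket 𝒯^{aΔ}_m ∘ 𝕋^{bΔ}_n − 𝒯^{bΔ}_n ∘ 𝕋^{aΔ}_m applied to 1.) -/
theorem rpow_ne_rpow_of_base_ne {s t c : ℝ} (hs : 0 < s) (ht : 0 < t) (hst : s ≠ t)
    (hc : c ≠ 0) : s ^ c ≠ t ^ c :=
  fun h => hst ((Real.rpow_left_inj hs.le ht.le hc).mp h)

/-- Factorization of the powers of `t` with exponents `c * _` occurring in the commutator. -/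
theorem rpow_conformal_exponents {t : ℝ} (ht : 0 < t) (c D m n : ℝ) :
    t ^ (c * (D * (m + 1))) = t ^ (c * D * m) * t ^ (c * D) ∧
    t ^ (c * D * (m + 1)) = t ^ (c * D * m) * t ^ (c * D) ∧
    t ^ (c * (D * (m + 1) + n + 1)) = t ^ (c * D * m) * t ^ (c * D) * t ^ (c * n) * t ^ c ∧
    t ^ (c * (n * (1 - D) + 1)) = t ^ (c * n) / t ^ (c * D * n) * t ^ c ∧
    t ^ (c * (D * (m + n + 1))) = t ^ (c * D * m) * t ^ (c * D * n) * t ^ (c * D) ∧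
    t ^ (c * (n + 1)) = t ^ (c * n) * t ^ c ∧
    t ^ (c * -(D * n)) = (t ^ (c * D * n))⁻¹ := by
  simp only [← Real.rpow_add ht, ← Real.rpow_sub ht, ← Real.rpow_neg ht.le]
  refine ⟨?_, ?_, ?_, ?_, ?_, ?_, ?_⟩ <;> congr 1 <;> ring

theorem rpow_conformal_exponents_add {t : ℝ} (ht : 0 < t) (a b D m n : ℝ) :
    t ^ ((a + b) * (D * (m + n + 1))) =
      t ^ (a * (D * (m + n + 1))) * t ^ (b * (D * (m + n + 1))) ∧
    t ^ ((a + b) * D * (m + n + 1)) =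
      t ^ (a * (D * (m + n + 1))) * t ^ (b * (D * (m + n + 1))) := by
  simp only [← Real.rpow_add ht]
  constructor <;> congr 1 <;> ring

/-- Super commutation relation for ℛ(p,q)-conformal super operators, coefficient identity. -/
theorem rpq_conformal_super_operator_commutator
    (t1 t2 : ℝ) (h1 : 0 < t1) (h2 : 0 < t2) (h12 : t1 ≠ t2)
    (a b : ℝ) (ha : a ≠ 0) (hb : b ≠ 0) (hab : a + b ≠ 0)
    (Δ : ℝ) (m n : ℤ) :
    tauNum t1 t2 b (Δ * ((n : ℝ) + 1)) * tauNum t1 t2 a (Δ * ((m : ℝ) + 1) + (n : ℝ) + 1)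
      - tauNum t1 t2 a (Δ * ((m : ℝ) + 1)) * tauNum t1 t2 b (Δ * ((n : ℝ) + 1) + (m : ℝ) + 1)
    = (t1 ^ (a + b) - t2 ^ (a + b)) / ((t1 ^ a - t2 ^ a) * (t1 ^ b - t2 ^ b)) *
        (t1 ^ (a * ((n : ℝ) * (1 - Δ) + 1)) / t1 ^ (b * Δ * (m : ℝ))
          - t1 ^ (b * ((m : ℝ) * (1 - Δ) + 1)) / t1 ^ (a * Δ * (n : ℝ))) *
        tauNum t1 t2 (a + b) (Δ * ((m : ℝ) + (n : ℝ) + 1))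
      - t2 ^ (b * Δ * ((n : ℝ) + 1)) / t1 ^ (a * Δ * (n : ℝ)) *
          ((t1 ^ (a * ((n : ℝ) + 1)) - t2 ^ (b * ((m : ℝ) + 1))) / (t1 ^ b - t2 ^ b)) *
          tauNum t1 t2 a (Δ * ((m : ℝ) + (n : ℝ) + 1))
      + t2 ^ (a * Δ * ((m : ℝ) + 1)) / t1 ^ (b * Δ * (m : ℝ)) *
          ((t1 ^ (b * ((m : ℝ) + 1)) - t2 ^ (a * ((n : ℝ) + 1))) / (t1 ^ a - t2 ^ a)) *
          tauNum t1 t2 b (Δ * ((m : ℝ) + (n : ℝ) + 1))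
      + t2 ^ ((a + b) * Δ * ((m : ℝ) + (n : ℝ) + 1)) *
          (tauNum t1 t2 b (-(Δ * (m : ℝ))) * tauNum t1 t2 a ((n : ℝ) * (1 - Δ) + 1)
            - tauNum t1 t2 a (-(Δ * (n : ℝ))) * tauNum t1 t2 b ((m : ℝ) * (1 - Δ) + 1)) := by
  have hda := sub_ne_zero.mpr (rpow_ne_rpow_of_base_ne h1 h2 h12 ha)
  have hdb := sub_ne_zero.mpr (rpow_ne_rpow_of_base_ne h1 h2 h12 hb)
  have hdab := sub_ne_zero.mpr (rpow_ne_rpow_of_base_ne h1 h2 h12 hab)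
  unfold tauNum
  generalize (m : ℝ) = m, (n : ℝ) = n
  simp only [(rpow_conformal_exponents_add h1 a b Δ m n).1,
    (rpow_conformal_exponents_add h2 a b Δ m n).1, (rpow_conformal_exponents_add h2 a b Δ m n).2]
  obtain ⟨p1, -, p3, p4, p5, p6, p7⟩ := rpow_conformal_exponents h1 a Δ m n
  obtain ⟨q1, q2, q3, q4, q5, q6, q7⟩ := rpow_conformal_exponents h2 a Δ m n
  obtain ⟨u1, -, u3, u4, u5, u6, u7⟩ := rpow_conformal_exponents h1 b Δ n m
  obtain ⟨v1, v2, v3, v4, v5, v6, v7⟩ := rpow_conformal_exponents h2 b Δ n m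
  rw [add_comm n m] at u5 v5
  simp only [p1, p3, p4, p5, p6, p7, q1, q2, q3, q4, q5, q6, q7, u1, u3, u4, u5, u6, u7,
    v1, v2, v3, v4, v5, v6, v7]
  have k1 := (Real.rpow_pos_of_pos h1 (a * Δ * n)).ne'
  have k2 := (Real.rpow_pos_of_pos h2 (a * Δ * n)).ne'
  have k3 := (Real.rpow_pos_of_pos h1 (b * Δ * m)).ne'
  have k4 := (Real.rpow_pos_of_pos h2 (b * Δ * m)).ne'
  generalize t1 ^ (a + b) - t2 ^ (a + b) = d at *
  generalize t1 ^ (a * Δ * n) = x1 at *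
  generalize t2 ^ (a * Δ * n) = x2 at *
  generalize t1 ^ (b * Δ * m) = y1 at *
  generalize t2 ^ (b * Δ * m) = y2 at *
  generalize t1 ^ (a * Δ * m) = x3, t2 ^ (a * Δ * m) = x4, t1 ^ (b * Δ * n) = y3,
    t2 ^ (b * Δ * n) = y4, t1 ^ (a * Δ) = z1, t2 ^ (a * Δ) = z2, t1 ^ (b * Δ) = z3,
    t2 ^ (b * Δ) = z4, t1 ^ (a * n) = w1, t2 ^ (a * n) = w2, t1 ^ (b * m) = w3,
    t2 ^ (b * m) = w4
  generalize t1 ^ a = A1, t2 ^ a = A2, t1 ^ b = B1, t2 ^ b = B2 at *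
  field_simp
  ring
end

section
/- (Super commutation relation for q-conformal super operators, Biedenharn–Macfarlane case.) Let q > 0 be real with q ≠ 1, let a, b be nonzero reals with a + b ≠ 0, let Δ ∈ ℝ and m, n ∈ ℤ, and write [x]_{q^c} = (q^{cx} − q^{−cx})/(q^c − q^{−c}). Then [Δ(n+1)]_{q^b}·[Δ(m+1)+n+1]_{q^a} − [Δ(m+1)]_{q^a}·[Δ(n+1)+m+1]_{q^b} = ((q^{a+b} − q^{−a−b})/((q^a − q^{−a})(q^b − q^{−b}))) · ( q^{a(n(1−Δ)+1)}/q^{bΔm} − q^{b(m(1−Δ)+1)}/q^{aΔn} ) · [Δ(m+n+1)]_{q^{a+b}} − (q^{−bΔ(n+1)}/q^{aΔn}) · ((q^{a(n+1)} − q^{−b(m+1)})/(q^b − q^{−b})) · [Δ(m+n+1)]_{q^a} + (q^{−aΔ(m+1)}/q^{bΔm}) · ((q^{b(m+1)} − q^{−a(n+1)})/(q^a − q^{−a})) · [Δ(m+n+1)]_{q^b} + q^{−(a+b)Δ(m+n+1)}·( [−Δm]_{q^b}·[n(1−Δ)+1]_{q^a} − [−Δn]_{q^a}·[m(1−Δ)+1]_{q^b}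 ). -/
/-- The symmetric q-deformed number `[x]_{q^c} = (q^{cx} - q^{-cx})/(q^c - q^{-c})`
(real powers of a positive base). -/
noncomputable def qSymNum (q c x : ℝ) : ℝ :=
  (q ^ (c * x) - q ^ (-(c * x))) / (q ^ c - q ^ (-c))

theorem rpow_sub_rpow_neg_ne_zero {q : ℝ} (hq : 0 < q) (hq1 : q ≠ 1) {c : ℝ} (hc : c ≠ 0) :
    q ^ c - q ^ (-c) ≠ 0 := by
  intro h
  have h' := (Real.rpow_right_inj hq hq1).mp (sub_eq_zero.mp h)
  exact hc (by linarith)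

/-- Super commutation relation for q-conformal super operators,
Biedenharn–Macfarlane case (τ₁ = q, τ₂ = q⁻¹). -/
theorem q_conformal_super_operator_commutator_BM
    (q : ℝ) (hq : 0 < q) (hq1 : q ≠ 1)
    (a b : ℝ) (ha : a ≠ 0) (hb : b ≠ 0) (hab : a + b ≠ 0)
    (Δ : ℝ) (m n : ℤ) :
    qSymNum q b (Δ * ((n : ℝ) + 1)) * qSymNum q a (Δ * ((m : ℝ) + 1) + (n : ℝ) + 1)
      - qSymNum q a (Δ * ((m : ℝ) + 1)) * qSymNum q b (Δ * ((n : ℝ) + 1) + (m : ℝ) + 1)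
    = (q ^ (a + b) - q ^ (-(a + b))) / ((q ^ a - q ^ (-a)) * (q ^ b - q ^ (-b))) *
        (q ^ (a * ((n : ℝ) * (1 - Δ) + 1)) / q ^ (b * Δ * (m : ℝ))
          - q ^ (b * ((m : ℝ) * (1 - Δ) + 1)) / q ^ (a * Δ * (n : ℝ))) *
        qSymNum q (a + b) (Δ * ((m : ℝ) + (n : ℝ) + 1))
      - q ^ (-(b * Δ * ((n : ℝ) + 1))) / q ^ (a * Δ * (n : ℝ)) *
          ((q ^ (a * ((n : ℝ) + 1)) - q ^ (-(b * ((m : ℝ) + 1)))) / (q ^ b - q ^ (-b))) *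
          qSymNum q a (Δ * ((m : ℝ) + (n : ℝ) + 1))
      + q ^ (-(a * Δ * ((m : ℝ) + 1))) / q ^ (b * Δ * (m : ℝ)) *
          ((q ^ (b * ((m : ℝ) + 1)) - q ^ (-(a * ((n : ℝ) + 1)))) / (q ^ a - q ^ (-a))) *
          qSymNum q b (Δ * ((m : ℝ) + (n : ℝ) + 1))
      + q ^ (-((a + b) * Δ * ((m : ℝ) + (n : ℝ) + 1))) *
          (qSymNum q b (-(Δ * (m : ℝ))) * qSymNum q a ((n : ℝ) * (1 - Δ) + 1)
            - qSymNum q a (-(Δ * (n : ℝ))) * qSymNum q b ((m : ℝ) * (1 - Δ) + 1)) := by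
  have hC := rpow_sub_rpow_neg_ne_zero hq hq1 hab
  have cancel (D X Y : ℝ) :
      (q ^ (a + b) - q ^ (-(a + b))) / D * X * (Y / (q ^ (a + b) - q ^ (-(a + b))))
        = X * Y / D := by
    field_simp
  simp only [qSymNum, cancel]
  generalize q ^ a - q ^ (-a) = A
  generalize q ^ b - q ^ (-b) = B
  simp only [div_eq_mul_inv _ (q ^ (_ : ℝ)), ← Real.rpow_neg hq.le]
  simp only [Real.rpow_def_of_pos hq]
  -- Only the numerators matter; expand them as sums of single exponentials.
  have collect (w x y z : ℝ) : w / B * (x / A) - y / A * (z / B) = (w * x - y * z) / (A * B) := by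
    ring
  have collect_left (w x y : ℝ) : w * (x / B) * (y / A) = w * x * y / (A * B) := by ring
  have collect_right (w x y : ℝ) : w * (x / A) * (y / B) = w * x * y / (A * B) := by ring
  simp only [collect, collect_left, collect_right]
  simp only [← mul_div_assoc, ← add_div, ← sub_div]
  congr 1
  simp only [sub_mul, mul_sub, ← Real.exp_add]
  ring_nf
end

section
/- (Super commutation relation for q-conformal super operators, one-parameter case.) Let q > 0 be real with q ≠ 1, let a, b be nonzero reals with a + b ≠ 0, let Δ ∈ ℝ and m, n ∈ ℤ, and write [x]_c = (q^{cx} − 1)/(q^c − 1). Then [Δ(n+1)]_b·[Δ(m+1)+n+1]_a − [Δ(m+1)]_a·[Δ(n+1)+m+1]_b = ((q^{a+b} − 1)/((q^a − 1)(q^b − 1))) · ( q^{a(n(1−Δ)+1)}/q^{bΔm} − q^{b(m(1−Δ)+1)}/q^{aΔn} ) · [Δ(m+n+1)]_{a+b} − (1/q^{aΔn}) · ((q^{a(n+1)} − 1)/(q^b − 1)) · [Δ(m+n+1)]_a + (1/q^{bΔm}) · ((q^{b(m+1)} − 1)/(q^a − 1)) · [Δ(m+n+1)]_b + ( [−Δm]_b·[n(1−Δ)+1]_a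 − [−Δn]_a·[m(1−Δ)+1]_b ). -/
/-- Super commutation relation for q-conformal super operators, one-parameter case
(τ₁ = q, τ₂ = 1). -/
theorem q_conformal_super_operator_commutator
    (q : ℝ) (hq : 0 < q) (hq1 : q ≠ 1)
    (a b : ℝ) (ha : a ≠ 0) (hb : b ≠ 0) (hab : a + b ≠ 0)
    (Δ : ℝ) (m n : ℤ) :
    qcNum q b (Δ * ((n : ℝ) + 1)) * qcNum q a (Δ * ((m : ℝ) + 1) + (n : ℝ) + 1)
      - qcNum q a (Δ * ((m : ℝ) + 1)) * qcNum q b (Δ * ((n : ℝ) + 1) + (m : ℝ) + 1)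
    = (q ^ (a + b) - 1) / ((q ^ a - 1) * (q ^ b - 1)) *
        (q ^ (a * ((n : ℝ) * (1 - Δ) + 1)) / q ^ (b * Δ * (m : ℝ))
          - q ^ (b * ((m : ℝ) * (1 - Δ) + 1)) / q ^ (a * Δ * (n : ℝ))) *
        qcNum q (a + b) (Δ * ((m : ℝ) + (n : ℝ) + 1))
      - 1 / q ^ (a * Δ * (n : ℝ)) *
          ((q ^ (a * ((n : ℝ) + 1)) - 1) / (q ^ b - 1)) *
          qcNum q a (Δ * ((m : ℝ) + (n : ℝ) + 1))
      + 1 / q ^ (b * Δ * (m : ℝ)) *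
          ((q ^ (b * ((m : ℝ) + 1)) - 1) / (q ^ a - 1)) *
          qcNum q b (Δ * ((m : ℝ) + (n : ℝ) + 1))
      + (qcNum q b (-(Δ * (m : ℝ))) * qcNum q a ((n : ℝ) * (1 - Δ) + 1)
          - qcNum q a (-(Δ * (n : ℝ))) * qcNum q b ((m : ℝ) * (1 - Δ) + 1)) := by
  have hA := rpow_sub_one_ne_zero hq hq1 ha
  have hB := rpow_sub_one_ne_zero hq hq1 hb
  have hAB := rpow_sub_one_ne_zero hq hq1 hab
  have rpow_shift_mul (c x y : ℝ) :
      q ^ (c * (Δ * (x + 1) + y + 1)) =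
        q ^ (c * Δ * x) * q ^ (c * Δ) * q ^ (c * y) * q ^ c := by
    simp only [← Real.rpow_add hq]
    ring_nf
  have rpow_mul_add_one (c x : ℝ) :
      q ^ (c * (Δ * (x + 1))) = q ^ (c * Δ * x) * q ^ (c * Δ) := by
    simp only [← Real.rpow_add hq]
    ring_nf
  have rpow_mul_add_add_one (c x y : ℝ) :
      q ^ (c * (Δ * (x + y + 1))) = q ^ (c * Δ * x) * q ^ (c * Δ * y) * q ^ (c * Δ) := by
    simp only [← Real.rpow_add hq]
    ring_nf
  have rpow_mul_one_sub (c x : ℝ) :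
      q ^ (c * (x * (1 - Δ) + 1)) = q ^ (c * x) * q ^ c / q ^ (c * Δ * x) := by
    simp only [← Real.rpow_add hq, ← Real.rpow_sub hq]
    ring_nf
  have rpow_mul_neg (c x : ℝ) : q ^ (c * -(Δ * x)) = 1 / q ^ (c * Δ * x) := by
    rw [one_div, ← Real.rpow_neg hq.le]
    ring_nf
  have rpow_succ (c x : ℝ) : q ^ (c * (x + 1)) = q ^ (c * x) * q ^ c := by
    rw [← Real.rpow_add hq]
    ring_nf
  have rpow_add_mul (x : ℝ) : q ^ ((a + b) * x) = q ^ (a * x) * q ^ (b * x) := by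
    rw [← Real.rpow_add hq, add_mul]
  have cancel_add (x : ℝ) :
      (q ^ (a + b) - 1) / ((q ^ a - 1) * (q ^ b - 1)) * x *
        qcNum q (a + b) (Δ * ((m : ℝ) + (n : ℝ) + 1)) =
      x * (q ^ ((a + b) * (Δ * ((m : ℝ) + (n : ℝ) + 1))) - 1) /
        ((q ^ a - 1) * (q ^ b - 1)) := by
    unfold qcNum
    field_simp
  rw [cancel_add, rpow_add_mul]
  simp only [qcNum, rpow_shift_mul, rpow_mul_add_add_one, rpow_mul_add_one,
    rpow_mul_one_sub, rpow_mul_neg, rpow_succ]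
  have h₁ := (Real.rpow_pos_of_pos hq (a * Δ * m)).ne'
  have h₂ := (Real.rpow_pos_of_pos hq (a * Δ * n)).ne'
  have h₃ := (Real.rpow_pos_of_pos hq (b * Δ * m)).ne'
  have h₄ := (Real.rpow_pos_of_pos hq (b * Δ * n)).ne'
  generalize q ^ (a * Δ * m) = am at *
  generalize q ^ (a * Δ * n) = an at *
  generalize q ^ (b * Δ * m) = bm at *
  generalize q ^ (b * Δ * n) = bn at *
  generalize q ^ (a * Δ) = ad
  generalize q ^ (b * Δ) = bd
  generalize q ^ (a * (n : ℝ)) = xn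
  generalize q ^ (b * (m : ℝ)) = ym
  generalize q ^ a = A at *
  generalize q ^ b = B at *
  field_simp
  ring
end
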